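/- arXiv:2205.01680 — 11 statements merged into one kernel-verified Lean document; each statement's English description precedes it below -/
import Mathlib

section
/- Minkowski space is globally hyperbolic in the sense of compact causal diamonds: for every pair of points x, y in M = ℝ × EuclideanSpace ℝ (Fin n), the causal diamond J⁺(y) ∩ J⁻(x) = {z : y ≼ z and z ≼ x} is a compact subset of M. -/
open Set

/-- Minkowski space: time coordinate × space. -/
abbrev Mink (n : ℕ) := ℝ × EuclideanSpace ℝ (Fin n)

/-- The causal relation `p ≼ q` on Minkowski space. -/
def causalRel {n : ℕ} (p q : Mink n) : Prop := ‖q.2 - p.2‖ ≤ q.1 - p.1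

theorem isClosed_setOf_causalRel {n : ℕ} {X : Type*} [TopologicalSpace X] {f g : X → Mink n}
    (hf : Continuous f) (hg : Continuous g) : IsClosed {z | causalRel (f z) (g z)} :=
  isClosed_le (by fun_prop) (by fun_prop)

/-- Minkowski space is globally hyperbolic: every causal diamond
`J⁺(y) ∩ J⁻(x)` is compact. -/
theorem minkowski_causal_diamond_compact (n : ℕ) (x y : Mink n) :
    IsCompact {z : Mink n | causalRel y z ∧ causalRel z x} := by
  have hK : IsCompact (Icc y.1 x.1 ×ˢ Metric.closedBall y.2 (x.1 - y.1)) :=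
    isCompact_Icc.prod (isCompact_closedBall _ _)
  refine hK.of_isClosed_subset
    ((isClosed_setOf_causalRel continuous_const continuous_id).inter
      (isClosed_setOf_causalRel continuous_id continuous_const)) ?_
  rintro z ⟨hyz, hzx⟩
  unfold causalRel at hyz hzx
  have hy := norm_nonneg (z.2 - y.2)
  have hx := norm_nonneg (x.2 - z.2)
  rw [mem_prod, mem_Icc, mem_closedBall_iff_norm]
  refine ⟨⟨?_, ?_⟩, ?_⟩ <;> linarith
end

section
/- Punctured Minkowski space has a locally naked singularity: let z, x ∈ M with z ≪ x, and define c : [0, 1) → M by c(t) = (z.1 − (1 − t), z.2). Then (i) c is a future-directed timelike curve, i.e. c(s) ≪ c(t) for 0 ≤ s < t < 1; (ii) c(t) tends to z as t → 1 from the left, so c is future-inextendible in the punctured space M \ {z}; and (iii) I⁻(c) ⊆ I⁻(x). -/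
open Set Filter Topology

/-- The chronological relation `p ≪ q` on Minkowski space. -/
def chronRel {n : ℕ} (p q : Mink n) : Prop := ‖q.2 - p.2‖ < q.1 - p.1

theorem chronRel.trans {n : ℕ} {p q r : Mink n} (hpq : chronRel p q) (hqr : chronRel q r) :
    chronRel p r := by
  unfold chronRel at *
  linarith [norm_sub_le_norm_sub_add_norm_sub r.2 q.2 p.2]

/-- Punctured Minkowski space has a locally naked singularity: the timelike
curve `c t = (z.1 - (1 - t), z.2)` on `[0,1)` is timelike, converges to the
removed point `z` (hence is future-inextendible in `M \ {z}`), and its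
chronological past is contained in `I⁻(x)` whenever `z ≪ x`. -/
theorem punctured_minkowski_locally_naked (n : ℕ) (z x : Mink n)
    (hzx : chronRel z x) (c : ℝ → Mink n)
    (hc : ∀ t : ℝ, c t = (z.1 - (1 - t), z.2)) :
    (∀ s t : ℝ, 0 ≤ s → s < t → t < 1 → chronRel (c s) (c t)) ∧
    Tendsto c (𝓝[<] (1 : ℝ)) (𝓝 z) ∧
    (∀ w : Mink n, (∃ t : ℝ, 0 ≤ t ∧ t < 1 ∧ chronRel w (c t)) → chronRel w x) := by
  obtain rfl : c = fun t => (z.1 - (1 - t), z.2) := funext hc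
  refine ⟨fun s t _ hst _ => by simpa [chronRel] using hst, ?_, ?_⟩
  · have hcont : Continuous fun t : ℝ => ((z.1 - (1 - t), z.2) : Mink n) := by fun_prop
    simpa using (hcont.tendsto 1).mono_left nhdsWithin_le_nhds
  · rintro w ⟨t, _, ht, hw⟩
    exact (hw.trans (by simpa [chronRel] using ht)).trans hzx
end

section
/- In Minkowski space, inclusion of chronological pasts characterizes the causal relation: for all points z, x ∈ M, one has I⁻(z) ⊆ I⁻(x) if and only if z ≼ x. -/
open Set

/-- The chronological past `I⁻(x)`. -/
def chronPast {n : ℕ} (x : Mink n) : Set (Mink n) := {w | chronRel w x}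

/-- Inclusion of chronological pasts characterizes the causal relation. -/
theorem chronPast_subset_iff_causal (n : ℕ) (z x : Mink n) :
    chronPast z ⊆ chronPast x ↔ causalRel z x := by
  constructor
  · intro h
    refine le_of_forall_pos_lt_add fun ε hε => ?_
    have hz : ((z.1 - ε, z.2) : Mink n) ∈ chronPast z := by
      simpa [chronPast, chronRel] using hε
    have hx : ‖x.2 - z.2‖ < x.1 - (z.1 - ε) := h hz
    linarith
  · intro h w hw
    have hzx : ‖x.2 - z.2‖ ≤ x.1 - z.1 := h
    have hwz : ‖z.2 - w.2‖ < z.1 - w.1 := hw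
    have htri := norm_sub_le_norm_sub_add_norm_sub x.2 z.2 w.2
    change ‖x.2 - w.2‖ < x.1 - w.1
    linarith
end

section
/- Minkowski space is past distinguishing: for all points x, y ∈ M, if I⁻(x) = I⁻(y) then x = y. -/
open Set

theorem norm_sub_le_of_chronPast_subset {n : ℕ} {x y : Mink n}
    (h : chronPast x ⊆ chronPast y) : ‖y.2 - x.2‖ ≤ y.1 - x.1 := by
  refine le_of_forall_pos_lt_add fun ε hε => ?_
  have hx : (x.1 - ε, x.2) ∈ chronPast x := by simpa [chronPast, chronRel] using hε
  have hy : ‖y.2 - x.2‖ < y.1 - (x.1 - ε) := h hx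
  linarith

/-- Minkowski space is past distinguishing. -/
theorem minkowski_past_distinguishing (n : ℕ) (x y : Mink n)
    (h : chronPast x = chronPast y) : x = y := by
  have hxy := norm_sub_le_of_chronPast_subset h.subset
  have hyx := norm_sub_le_of_chronPast_subset h.superset
  have h₁ := norm_nonneg (y.2 - x.2)
  have h₂ := norm_nonneg (x.2 - y.2)
  refine Prod.ext (by linarith) ?_
  exact sub_eq_zero.mp (norm_le_zero_iff.mp (by linarith))
end

section
/- Achronal boundaries in Minkowski space are Lipschitz hypersurfaces (the Minkowski case of Penrose's lemma that an achronal boundary such as ∂I⁺(S) is a locally Lipschitz topological hypersurface): let A ⊆ M be nonempty with time coordinates bounded below, i.e. there is T ∈ ℝ with a.1 ≥ T for all a ∈ A. Define f : EuclideanSpace ℝ (Fin n) → ℝ by f(v) = inf{t : (t, v) ∈ I⁺(A)}. Then f is well-defined and Lipschitz with constant 1, and the topological frontier of I⁺(A) equals the graph {(f(v), v) : v ∈ EuclideanSpace ℝ (Fin n)}. -/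
open Set

/-- The chronological future `I⁺(A)` of a set `A`. -/
def chronFuture {n : ℕ} (A : Set (Mink n)) : Set (Mink n) :=
  {q | ∃ a ∈ A, chronRel a q}

theorem chronRel.dist_add {n : ℕ} {a : Mink n} {s t : ℝ} {v w : EuclideanSpace ℝ (Fin n)}
    (h : chronRel a (s, v)) (hst : s + dist w v ≤ t) : chronRel a (t, w) := by
  simp only [chronRel, ← dist_eq_norm] at h ⊢
  linarith [dist_triangle w v a.2]

theorem chronFuture_dist_add {n : ℕ} {A : Set (Mink n)} {s t : ℝ}
    {v w : EuclideanSpace ℝ (Fin n)} (h : ((s, v) : Mink n) ∈ chronFuture A)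
    (hst : s + dist w v ≤ t) : ((t, w) : Mink n) ∈ chronFuture A :=
  let ⟨a, ha, hr⟩ := h
  ⟨a, ha, hr.dist_add hst⟩

theorem chronFuture_fiber_nonempty {n : ℕ} {A : Set (Mink n)} (hA : A.Nonempty)
    (v : EuclideanSpace ℝ (Fin n)) :
    {t : ℝ | ((t, v) : Mink n) ∈ chronFuture A}.Nonempty := by
  obtain ⟨a, ha⟩ := hA
  refine ⟨a.1 + ‖v - a.2‖ + 1, a, ha, ?_⟩
  simp only [chronRel]
  linarith

theorem chronFuture_fiber_bddBelow {n : ℕ} {A : Set (Mink n)} {T : ℝ}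
    (hT : ∀ a ∈ A, T ≤ a.1) (v : EuclideanSpace ℝ (Fin n)) :
    BddBelow {t : ℝ | ((t, v) : Mink n) ∈ chronFuture A} := by
  refine ⟨T, ?_⟩
  rintro t ⟨a, ha, hr⟩
  simp only [chronRel] at hr
  linarith [hT a ha, norm_nonneg (v - a.2)]

/-- The chronological future is the strict epigraph of the infimum of its fibers. -/
theorem mem_chronFuture_iff_sInf_lt {n : ℕ} {A : Set (Mink n)} (hA : A.Nonempty) {T : ℝ}
    (hT : ∀ a ∈ A, T ≤ a.1) (t : ℝ) (v : EuclideanSpace ℝ (Fin n)) :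
    ((t, v) : Mink n) ∈ chronFuture A ↔
      sInf {s : ℝ | ((s, v) : Mink n) ∈ chronFuture A} < t := by
  constructor
  · rintro ⟨a, ha, hr⟩
    simp only [chronRel] at hr
    have hmem : (((t + (a.1 + ‖v - a.2‖)) / 2, v) : Mink n) ∈ chronFuture A :=
      ⟨a, ha, by simp only [chronRel]; linarith⟩
    exact (csInf_le (chronFuture_fiber_bddBelow hT v) hmem).trans_lt (by linarith)
  · intro h
    obtain ⟨s, hs, hst⟩ := exists_lt_of_csInf_lt (chronFuture_fiber_nonempty hA v) h
    exact chronFuture_dist_add hs (by simpa using hst.le)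

/-- The frontier of the strict epigraph of a continuous function is its graph. -/
theorem frontier_strict_epigraph {E : Type*} [TopologicalSpace E] {f : E → ℝ}
    (hf : Continuous f) : frontier {p : ℝ × E | f p.2 < p.1} = {p | p.1 = f p.2} := by
  have hf2 : Continuous fun p : ℝ × E => f p.2 := hf.comp continuous_snd
  refine Subset.antisymm (fun p hp => (frontier_lt_subset_eq hf2 continuous_fst hp).symm) ?_
  rintro ⟨t, v⟩ (rfl : t = f v)
  rw [(isOpen_lt hf2 continuous_fst).frontier_eq]
  refine ⟨?_, fun h => lt_irrefl (f v) h⟩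
  have hv : f v ∈ closure (Ioi (f v)) := by simp
  exact map_mem_closure (f := fun t : ℝ => (t, v)) (by fun_prop) hv fun t ht => ht

/-- Achronal boundaries in Minkowski space are Lipschitz graphs: for a
nonempty set `A` whose time coordinates are bounded below, the function
`f v = inf {t | (t,v) ∈ I⁺(A)}` is well defined and 1-Lipschitz, and the
frontier of `I⁺(A)` is the graph of `f`. -/
theorem achronal_boundary_lipschitz_graph (n : ℕ) (A : Set (Mink n))
    (hA : A.Nonempty) (T : ℝ) (hT : ∀ a ∈ A, T ≤ a.1)
    (f : EuclideanSpace ℝ (Fin n) → ℝ)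
    (hf : ∀ v, f v = sInf {t : ℝ | ((t, v) : Mink n) ∈ chronFuture A}) :
    (∀ v, {t : ℝ | ((t, v) : Mink n) ∈ chronFuture A}.Nonempty ∧
        BddBelow {t : ℝ | ((t, v) : Mink n) ∈ chronFuture A}) ∧
    LipschitzWith 1 f ∧
    frontier (chronFuture A) = {p : Mink n | p.1 = f p.2} := by
  have hmem : ∀ t v, ((t, v) : Mink n) ∈ chronFuture A ↔ f v < t := fun t v => by
    rw [hf v, mem_chronFuture_iff_sInf_lt hA hT]
  have hlip : LipschitzWith 1 f := by
    refine LipschitzWith.of_le_add fun x y => le_of_forall_pos_le_add fun ε hε => ?_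
    have hy := (hmem (f y + ε) y).2 (by linarith)
    linarith [(hmem _ x).1 (chronFuture_dist_add hy le_rfl)]
  refine ⟨fun v => ⟨chronFuture_fiber_nonempty hA v, chronFuture_fiber_bddBelow hT v⟩, hlip, ?_⟩
  have hset : chronFuture A = {p : Mink n | f p.2 < p.1} := ext fun p => hmem p.1 p.2
  rw [hset, frontier_strict_epigraph hlip.continuous]
end

section
/- Integrated causality for causal curves in Minkowski space: if c : [a, b] → M is continuously differentiable and its derivative is future-directed causal at every t ∈ [a, b], i.e. ‖(c′(t)).2‖ ≤ (c′(t)).1, then the endpoints are causally related: ‖c(b).2 − c(a).2‖ ≤ c(b).1 − c(a).1, i.e. c(a) ≼ c(b). -/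
open Set

/-- Integrated causality: a C¹ curve with future-directed causal derivative
has causally related endpoints. -/
theorem causal_curve_endpoints_causal (n : ℕ) (a b : ℝ) (hab : a ≤ b)
    (c c' : ℝ → Mink n)
    (hderiv : ∀ t ∈ Icc a b, HasDerivAt c (c' t) t)
    (hcont : ContinuousOn c' (Icc a b))
    (hcausal : ∀ t ∈ Icc a b, ‖(c' t).2‖ ≤ (c' t).1) :
    causalRel (c a) (c b) := by
  have hspace : ∀ t ∈ Icc a b, HasDerivAt (fun s => (c s).2 - (c a).2) (c' t).2 t := fun t ht =>
    ((ContinuousLinearMap.snd ℝ ℝ (EuclideanSpace ℝ (Fin n))).hasFDerivAt.comp_hasDerivAt t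
      (hderiv t ht)).sub_const _
  have htime : ∀ t ∈ Icc a b, HasDerivAt (fun s => (c s).1 - (c a).1) (c' t).1 t := fun t ht =>
    ((ContinuousLinearMap.fst ℝ ℝ (EuclideanSpace ℝ (Fin n))).hasFDerivAt.comp_hasDerivAt t
      (hderiv t ht)).sub_const _
  exact image_norm_le_of_norm_deriv_right_le_deriv_boundary'
    (fun t ht => (hspace t ht).continuousAt.continuousWithinAt)
    (fun t ht => (hspace t (Ico_subset_Icc_self ht)).hasDerivWithinAt)
    (by simp)
    (fun t ht => (htime t ht).continuousAt.continuousWithinAt)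
    (fun t ht => (htime t (Ico_subset_Icc_self ht)).hasDerivWithinAt)
    (fun t ht => hcausal t (Ico_subset_Icc_self ht))
    (right_mem_Icc.2 hab)
end

section
/- Null rigidity in Minkowski space (two points connected by a lightlike curve but not by a timelike curve are connected by a null geodesic): let c : [a, b] → M be continuously differentiable with future-directed causal derivative at every t ∈ [a, b], i.e. ‖(c′(t)).2‖ ≤ (c′(t)).1. If the endpoints are null separated and distinct, i.e. c(b).1 − c(a).1 = ‖c(b).2 − c(a).2‖ and c(a) ≠ c(b), then c is contained in the straight null segment from c(a) to c(b): for every t ∈ [a, b] there exists λ ∈ [0, 1] with c(t) = c(a) + λ • (c(b) − c(a)). -/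
open Set

/-- A curve whose speed is bounded by the derivative of `τ` has displacement bounded by the
increment of `τ`. -/
theorem norm_sub_le_sub_of_norm_deriv_le {E : Type*} [NormedAddCommGroup E] [NormedSpace ℝ E]
    {a b : ℝ} (hab : a ≤ b) {f f' : ℝ → E} {τ τ' : ℝ → ℝ}
    (hf : ∀ t ∈ Icc a b, HasDerivAt f (f' t) t) (hτ : ∀ t ∈ Icc a b, HasDerivAt τ (τ' t) t)
    (hle : ∀ t ∈ Icc a b, ‖f' t‖ ≤ τ' t) : ‖f b - f a‖ ≤ τ b - τ a := by
  have hf₀ : ∀ t ∈ Icc a b, HasDerivAt (fun s => f s - f a) (f' t) t :=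
    fun t ht => (hf t ht).sub_const _
  have hτ₀ : ∀ t ∈ Icc a b, HasDerivAt (fun s => τ s - τ a) (τ' t) t :=
    fun t ht => (hτ t ht).sub_const _
  exact image_norm_le_of_norm_deriv_right_le_deriv_boundary'
    (fun t ht => (hf₀ t ht).continuousAt.continuousWithinAt)
    (fun t ht => (hf₀ t (Ico_subset_Icc_self ht)).hasDerivWithinAt)
    (by simp)
    (fun t ht => (hτ₀ t ht).continuousAt.continuousWithinAt)
    (fun t ht => (hτ₀ t (Ico_subset_Icc_self ht)).hasDerivWithinAt)
    (fun t ht => hle t (Ico_subset_Icc_self ht)) (right_mem_Icc.2 hab)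

/-- Equality case of the reverse triangle inequality for two causal vectors whose sum is null. -/
theorem exists_eq_smul_add_of_null_add {E : Type*} [NormedAddCommGroup E] [NormedSpace ℝ E]
    [StrictConvexSpace ℝ E] {u v : ℝ × E} (hu : ‖u.2‖ ≤ u.1) (hv : ‖v.2‖ ≤ v.1)
    (hnull : (u + v).1 = ‖(u + v).2‖) (hne : u + v ≠ 0) :
    ∃ r ∈ Icc (0 : ℝ) 1, u = r • (u + v) := by
  rw [Prod.fst_add, Prod.snd_add] at hnull
  have htri := norm_add_le u.2 v.2
  have hu' : ‖u.2‖ = u.1 := by linarith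
  have hv' : ‖v.2‖ = v.1 := by linarith
  have hu₀ : 0 ≤ u.1 := hu' ▸ norm_nonneg _
  have hv₀ : 0 ≤ v.1 := hv' ▸ norm_nonneg _
  have hray : u.1 • v.2 = v.1 • u.2 := by
    rw [← hu', ← hv']
    exact (sameRay_iff_norm_add.2 (by linarith)).norm_smul_eq
  have hsum : u.1 + v.1 ≠ 0 := by
    intro h
    apply hne
    ext1
    · simpa using h
    · rw [h] at hnull
      simpa using hnull.symm
  have hpos : 0 < u.1 + v.1 := lt_of_le_of_ne (by positivity) hsum.symm
  refine ⟨u.1 / (u.1 + v.1), ⟨by positivity, ?_⟩, ?_⟩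
  · rw [div_le_one hpos]
    linarith
  · ext1
    · rw [Prod.smul_fst, Prod.fst_add, smul_eq_mul, div_mul_cancel₀ _ hsum]
    · rw [Prod.smul_snd, Prod.snd_add, div_eq_inv_mul, mul_smul, smul_add, hray, ← add_smul,
        inv_smul_smul₀ hsum]

/-- Null rigidity in Minkowski space: a C¹ future-directed causal curve with
distinct null separated endpoints lies on the straight null segment joining
them. -/
theorem null_rigidity (n : ℕ) (a b : ℝ) (hab : a ≤ b)
    (c c' : ℝ → Mink n)
    (hderiv : ∀ t ∈ Icc a b, HasDerivAt c (c' t) t)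
    (hcont : ContinuousOn c' (Icc a b))
    (hcausal : ∀ t ∈ Icc a b, ‖(c' t).2‖ ≤ (c' t).1)
    (hnull : (c b).1 - (c a).1 = ‖(c b).2 - (c a).2‖)
    (hne : c a ≠ c b) :
    ∀ t ∈ Icc a b, ∃ lam ∈ Icc (0 : ℝ) 1,
      c t = c a + lam • (c b - c a) := by
  intro t ht
  have hsnd : ∀ s ∈ Icc a b, HasDerivAt (fun s => (c s).2) (c' s).2 s :=
    fun s hs => (hderiv s hs).snd
  have hfst : ∀ s ∈ Icc a b, HasDerivAt (fun s => (c s).1) (c' s).1 s :=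
    fun s hs => (hderiv s hs).fst
  have hleft : Icc a t ⊆ Icc a b := Icc_subset_Icc_right ht.2
  have hright : Icc t b ⊆ Icc a b := Icc_subset_Icc_left ht.1
  have hu := norm_sub_le_sub_of_norm_deriv_le ht.1 (fun s hs => hsnd s (hleft hs))
    (fun s hs => hfst s (hleft hs)) (fun s hs => hcausal s (hleft hs))
  have hv := norm_sub_le_sub_of_norm_deriv_le ht.2 (fun s hs => hsnd s (hright hs))
    (fun s hs => hfst s (hright hs)) (fun s hs => hcausal s (hright hs))
  have hadd : (c t - c a) + (c b - c t) = c b - c a := by abel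
  obtain ⟨r, hr, h⟩ := exists_eq_smul_add_of_null_add (u := c t - c a) (v := c b - c t) hu hv
    (by rw [hadd]; exact hnull) (by rw [hadd]; exact sub_ne_zero.2 hne.symm)
  rw [hadd] at h
  exact ⟨r, hr, by rw [← h]; abel⟩
end

section
/- Null Raychaudhuri focusing inequality (the ODE core of Penrose's 1965 singularity theorem, giving a focal point on each null geodesic ruling the boundary of the future of a trapped surface): let b ∈ (0, ∞], let θ : ℝ → ℝ be differentiable on [0, b) with θ(0) = θ₀ < 0 and θ′(t) ≤ −θ(t)²/2 for all t ∈ [0, b). Then b ≤ 2/(−θ₀); in particular θ cannot be defined (satisfying this differential inequality) on all of [0, ∞). -/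
open Set

/-- A function on `[0, T]` that is negative at `0` and satisfies `θ' ≤ -θ²/2` has
`T < 2 / (-θ 0)`. -/
theorem lt_two_div_neg_of_hasDerivWithinAt_le_neg_sq_div_two {θ θ' : ℝ → ℝ} {T : ℝ} (hT : 0 ≤ T)
    (hneg : θ 0 < 0) (hderiv : ∀ t ∈ Icc 0 T, HasDerivWithinAt θ (θ' t) (Icc 0 T) t)
    (hineq : ∀ t ∈ Icc 0 T, θ' t ≤ -(θ t) ^ 2 / 2) : T < 2 / (-θ 0) := by
  have h0 : (0 : ℝ) ∈ Icc 0 T := left_mem_Icc.2 hT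
  have hanti : AntitoneOn θ (Icc 0 T) :=
    antitoneOn_of_hasDerivWithinAt_nonpos (f' := θ') (convex_Icc 0 T)
      (fun t ht => (hderiv t ht).continuousWithinAt)
      (fun t ht => (hderiv t (interior_subset ht)).mono interior_subset)
      (fun t ht => (hineq t (interior_subset ht)).trans (by nlinarith [sq_nonneg (θ t)]))
  have hlt : ∀ t ∈ Icc 0 T, θ t < 0 := fun t ht => (hanti h0 ht ht.1).trans_lt hneg
  have hg : ∀ t ∈ Icc 0 T, HasDerivWithinAt (fun s => (θ s)⁻¹ - s / 2)
      (-θ' t / θ t ^ 2 - 1 / 2) (Icc 0 T) t := fun t ht =>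
    ((hderiv t ht).fun_inv (hlt t ht).ne).sub ((hasDerivWithinAt_id t _).div_const 2)
  have hmono : MonotoneOn (fun s => (θ s)⁻¹ - s / 2) (Icc 0 T) := by
    refine monotoneOn_of_hasDerivWithinAt_nonneg (convex_Icc 0 T)
      (fun t ht => (hg t ht).continuousWithinAt)
      (fun t ht => (hg t (interior_subset ht)).mono interior_subset) (fun t ht => ?_)
    have ht' := interior_subset ht
    have hpos : 0 < θ t ^ 2 := sq_pos_of_neg (hlt t ht')
    rw [sub_nonneg, le_div_iff₀ hpos]
    linarith [hineq t ht']
  have hle := hmono h0 (right_mem_Icc.2 hT) hT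
  have hinv : (θ T)⁻¹ < 0 := inv_lt_zero.2 (hlt T (right_mem_Icc.2 hT))
  have heq : 2 / (-θ 0) = -2 * (θ 0)⁻¹ := by rw [div_neg, div_eq_mul_inv, neg_mul]
  simp only [zero_div, sub_zero] at hle
  linarith

/-- Null Raychaudhuri focusing inequality: if the expansion `θ` of a null
geodesic congruence satisfies `θ' ≤ -θ²/2` on `[0,b)` with `θ 0 = θ₀ < 0`,
then `b ≤ 2/(-θ₀)`; in particular `θ` cannot exist on all of `[0,∞)`. -/
theorem null_raychaudhuri_focusing (b : EReal) (hb : 0 < b)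
    (θ θ' : ℝ → ℝ) (θ₀ : ℝ) (hθ₀ : θ 0 = θ₀) (hneg : θ₀ < 0)
    (hderiv : ∀ t : ℝ, 0 ≤ t → (t : EReal) < b →
      HasDerivWithinAt θ (θ' t) {s : ℝ | 0 ≤ s ∧ (s : EReal) < b} t)
    (hineq : ∀ t : ℝ, 0 ≤ t → (t : EReal) < b → θ' t ≤ -(θ t) ^ 2 / 2) :
    b ≤ ((2 / (-θ₀) : ℝ) : EReal) := by
  by_contra! h
  subst hθ₀
  have hT : 0 ≤ 2 / (-θ 0) := div_nonneg zero_le_two (neg_nonneg.2 hneg.le)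
  have hlt : ∀ t ∈ Icc 0 (2 / (-θ 0)), (t : EReal) < b := fun t ht =>
    (EReal.coe_le_coe_iff.2 ht.2).trans_lt h
  exact lt_irrefl _ (lt_two_div_neg_of_hasDerivWithinAt_le_neg_sq_div_two hT hneg
    (fun t ht => (hderiv t ht.1 (hlt t ht)).mono fun s hs => ⟨hs.1, hlt s hs⟩)
    (fun t ht => hineq t ht.1 (hlt t ht)))
end

section
/- Timelike Raychaudhuri past-focusing inequality (the ODE core of Raychaudhuri's 1955 cosmological singularity theorem: an expanding irrotational dust universe has a singular state at most 3/θ(0) in the past): let a < 0 and let θ : ℝ → ℝ be differentiable on (a, 0] with θ(0) = θ₀ > 0 and θ′(t) ≤ −θ(t)²/3 for all t ∈ (a, 0]. Then a ≥ −3/θ₀. -/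
open Set

/-- Timelike Raychaudhuri past-focusing inequality: if the expansion `θ` of
an irrotational timelike geodesic congruence satisfies `θ' ≤ -θ²/3` on
`(a,0]` with `θ 0 = θ₀ > 0`, then `a ≥ -3/θ₀`. -/
theorem timelike_raychaudhuri_past_focusing (a : ℝ) (ha : a < 0)
    (θ θ' : ℝ → ℝ) (θ₀ : ℝ) (hθ₀ : θ 0 = θ₀) (hpos : 0 < θ₀)
    (hderiv : ∀ t : ℝ, a < t → t ≤ 0 → HasDerivWithinAt θ (θ' t) (Ioc a 0) t)
    (hineq : ∀ t : ℝ, a < t → t ≤ 0 → θ' t ≤ -(θ t) ^ 2 / 3) :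
    -3 / θ₀ ≤ a := by
  have h0 : (0 : ℝ) ∈ Ioc a 0 := ⟨ha, le_rfl⟩
  have hanti : AntitoneOn θ (Ioc a 0) := by
    refine antitoneOn_of_hasDerivWithinAt_nonpos (f' := θ') (convex_Ioc a 0)
      (fun t ht => (hderiv t ht.1 ht.2).continuousWithinAt) (fun t ht => ?_) (fun t ht => ?_)
    · have ht' := interior_subset ht
      exact (hderiv t ht'.1 ht'.2).mono interior_subset
    · have ht' := interior_subset ht
      nlinarith [hineq t ht'.1 ht'.2, sq_nonneg (θ t)]
  have hθpos : ∀ t ∈ Ioc a 0, 0 < θ t := fun t ht =>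
    hpos.trans_le (hθ₀ ▸ hanti ht h0 ht.2)
  have hder : ∀ t ∈ Ioc a 0, HasDerivWithinAt (fun s => (θ s)⁻¹ - s / 3)
      (-θ' t / θ t ^ 2 - 1 / 3) (Ioc a 0) t := fun t ht =>
    ((hderiv t ht.1 ht.2).fun_inv (hθpos t ht).ne').sub ((hasDerivWithinAt_id t _).div_const 3)
  have hmono : MonotoneOn (fun s => (θ s)⁻¹ - s / 3) (Ioc a 0) := by
    refine monotoneOn_of_hasDerivWithinAt_nonneg (convex_Ioc a 0)
      (fun t ht => (hder t ht).continuousWithinAt)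
      (fun t ht => (hder t (interior_subset ht)).mono interior_subset) (fun t ht => ?_)
    have ht' := interior_subset ht
    rw [sub_nonneg, le_div_iff₀ (pow_pos (hθpos t ht') 2)]
    linarith [hineq t ht'.1 ht'.2]
  by_contra! hlt
  have hb : -3 / θ₀ ∈ Ioc a 0 := ⟨hlt, div_nonpos_of_nonpos_of_nonneg (by norm_num) hpos.le⟩
  have hle := hmono hb h0 hb.2
  have hinv := inv_pos.mpr (hθpos _ hb)
  simp only [hθ₀] at hle
  have heq : -3 / θ₀ / 3 = -θ₀⁻¹ := by field_simp
  linarith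
end

section
/- Clarke's wiggling lemma in Minkowski space (any two points that can be connected by a timelike curve can be connected by a timelike curve of arbitrarily small proper length, which makes Einstein's 1918 finite-distance criterion for singularities vacuous): assume n ≥ 1, let x, y ∈ M with x ≪ y and let ε > 0. Then there exist k ≥ 1 and points p₀, p₁, …, p_k ∈ M with p₀ = x, p_k = y, p_{i−1} ≪ p_i for 1 ≤ i ≤ k, and ∑_{i=1}^{k} τ(p_{i−1}, p_i) < ε. -/
open Set Finset

/-- The proper time separation of chronologically related points. -/
noncomputable def properTime {n : ℕ} (p q : Mink n) : ℝ :=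
  Real.sqrt ((q.1 - p.1) ^ 2 - ‖q.2 - p.2‖ ^ 2)

/-- In positive dimension every vector is its norm times a unit vector. -/
lemma exists_unit_smul_eq {n : ℕ} (hn : 1 ≤ n) (v : EuclideanSpace ℝ (Fin n)) :
    ∃ e : EuclideanSpace ℝ (Fin n), ‖e‖ = 1 ∧ v = ‖v‖ • e := by
  by_cases hv : v = 0
  · exact ⟨EuclideanSpace.single ⟨0, hn⟩ 1, by simp, by simp [hv]⟩
  · have h : ‖v‖ ≠ 0 := norm_ne_zero_iff.mpr hv
    exact ⟨‖v‖⁻¹ • v, by simp [norm_smul, h], by simp [smul_smul, h]⟩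

/-- A segment whose time extent exceeds its spatial extent by `δ` has small proper time. -/
lemma properTime_lt_of_norm_eq {n : ℕ} {p q : Mink n} {δ η : ℝ} (hη : 0 < η)
    (hnorm : ‖q.2 - p.2‖ = q.1 - p.1 - δ) (h : 2 * (q.1 - p.1) * δ < η ^ 2) :
    properTime p q < η := by
  rw [properTime, hnorm, Real.sqrt_lt' hη]
  nlinarith [sq_nonneg δ]

/-- Chronologically related points have an intermediate point to which both are joined
by nearly null segments. -/
lemma exists_nearly_null_intermediate {n : ℕ} (hn : 1 ≤ n) {x y : Mink n}
    (hxy : chronRel x y) {η : ℝ} (hη : 0 < η) :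
    ∃ z : Mink n, chronRel x z ∧ chronRel z y ∧ properTime x z < η ∧ properTime z y < η := by
  obtain ⟨e, he, hv⟩ := exists_unit_smul_eq hn (y.2 - x.2)
  unfold chronRel at hxy
  have hr := norm_nonneg (y.2 - x.2)
  set r := ‖y.2 - x.2‖
  set T := y.1 - x.1 with hT
  have hT0 : 0 < T := hr.trans_lt hxy
  obtain ⟨δ, hδ, hδlt⟩ : ∃ δ, 0 < δ ∧ δ < min ((T - r) / 2) (η ^ 2 / (2 * T)) :=
    exists_between (lt_min (by linarith) (by positivity))
  obtain ⟨hδu, hδη⟩ := lt_min_iff.mp hδlt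
  rw [lt_div_iff₀ (by positivity)] at hδη
  let z : Mink n := (x.1 + (T + r) / 2, x.2 + ((T + r) / 2 - δ) • e)
  have hz1 : z.1 - x.1 = (T + r) / 2 := by simp [z]
  have hz2 : y.1 - z.1 = (T - r) / 2 := by simp only [z]; linarith
  have hxz : ‖z.2 - x.2‖ = z.1 - x.1 - δ := by
    rw [hz1]
    simp only [z, add_sub_cancel_left, norm_smul, he, mul_one, Real.norm_eq_abs]
    exact abs_of_nonneg (by linarith)
  have hzy : ‖y.2 - z.2‖ = y.1 - z.1 - δ := by
    have h : y.2 - z.2 = (r - ((T + r) / 2 - δ)) • e := by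
      rw [sub_smul, ← hv]
      simp only [z]
      abel
    rw [h, hz2, norm_smul, he, mul_one, Real.norm_eq_abs, abs_of_nonpos (by linarith)]
    ring
  refine ⟨z, ?_, ?_, properTime_lt_of_norm_eq hη hxz ?_, properTime_lt_of_norm_eq hη hzy ?_⟩
  · unfold chronRel; linarith
  · unfold chronRel; linarith
  · rw [hz1]; nlinarith
  · rw [hz2]; nlinarith

/-- Clarke's wiggling lemma: any two chronologically related points of
Minkowski space (`n ≥ 1`) can be joined by a piecewise-linear timelike curve
of proper length less than any given `ε > 0`. -/
theorem timelike_curve_of_small_proper_length (n : ℕ) (hn : 1 ≤ n)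
    (x y : Mink n) (hxy : chronRel x y) (ε : ℝ) (hε : 0 < ε) :
    ∃ (k : ℕ) (p : ℕ → Mink n), 1 ≤ k ∧ p 0 = x ∧ p k = y ∧
      (∀ i : ℕ, 1 ≤ i → i ≤ k → chronRel (p (i - 1)) (p i)) ∧
      ∑ i ∈ Finset.Icc 1 k, properTime (p (i - 1)) (p i) < ε := by
  obtain ⟨z, hxz, hzy, h1, h2⟩ := exists_nearly_null_intermediate hn hxy (half_pos hε)
  refine ⟨2, fun i => if i = 0 then x else if i = 1 then z else y, by norm_num, by simp,
    by simp, fun i hi hi' => ?_, ?_⟩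
  · interval_cases i
    · simpa using hxz
    · simpa using hzy
  · rw [Finset.sum_Icc_succ_top (by norm_num), Finset.Icc_self, Finset.sum_singleton]
    simp only [Nat.sub_self, Nat.reduceAdd, Nat.reduceSub, one_ne_zero, OfNat.ofNat_ne_zero,
      OfNat.ofNat_ne_one, if_true, if_false]
    linarith
end

section
/- The straight timelike segment maximizes proper length in Minkowski space: let c : [a, b] → M be continuously differentiable with future-directed timelike derivative at every t ∈ [a, b], i.e. ‖(c′(t)).2‖ < (c′(t)).1. Then c(a) ≪ c(b) and the proper length of c satisfies ∫_a^b √((c′(t)).1² − ‖(c′(t)).2‖²) dt ≤ τ(c(a), c(b)). -/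
open Set

/-- Minkowski's integral inequality for the Euclidean norm on a product. -/
theorem sqrt_sq_integral_add_sq_norm_integral_le {E : Type*} [NormedAddCommGroup E]
    [NormedSpace ℝ E] [CompleteSpace E] {a b : ℝ} (hab : a ≤ b) {f : ℝ → ℝ} {g : ℝ → E}
    (hf : ContinuousOn f (Icc a b)) (hg : ContinuousOn g (Icc a b)) :
    √((∫ t in a..b, f t) ^ 2 + ‖∫ t in a..b, g t‖ ^ 2) ≤
      ∫ t in a..b, √(f t ^ 2 + ‖g t‖ ^ 2) := by
  have hint : IntervalIntegrable (fun t => (f t, g t)) MeasureTheory.volume a b :=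
    (hf.prodMk hg).intervalIntegrable_of_Icc hab
  have hfst := (ContinuousLinearMap.fst ℝ ℝ E).intervalIntegral_comp_comm hint
  have hsnd := (ContinuousLinearMap.snd ℝ ℝ E).intervalIntegral_comp_comm hint
  have hLp := (WithLp.prodContinuousLinearEquiv 2 ℝ ℝ E).symm.toContinuousLinearMap
    |>.intervalIntegral_comp_comm hint
  have hle := intervalIntegral.norm_integral_le_integral_norm (μ := MeasureTheory.volume)
    (f := fun t => WithLp.toLp 2 (f t, g t)) hab
  simp only [ContinuousLinearMap.coe_fst', ContinuousLinearMap.coe_snd',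
    ContinuousLinearEquiv.coe_coe, WithLp.prodContinuousLinearEquiv_symm_apply] at hfst hsnd hLp
  rw [hLp] at hle
  simp only [WithLp.prod_norm_eq_of_L2, Real.norm_eq_abs, sq_abs] at hle
  rw [hfst, hsnd]
  exact hle

/-- The straight timelike segment maximizes proper length: the proper length
of a C¹ future-directed timelike curve is at most the proper time separation
of its endpoints. -/
theorem straight_segment_maximizes_proper_length (n : ℕ) (a b : ℝ) (hab : a < b)
    (c c' : ℝ → Mink n)
    (hderiv : ∀ t ∈ Icc a b, HasDerivAt c (c' t) t)
    (hcont : ContinuousOn c' (Icc a b))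
    (htl : ∀ t ∈ Icc a b, ‖(c' t).2‖ < (c' t).1) :
    chronRel (c a) (c b) ∧
    ∫ t in a..b, Real.sqrt ((c' t).1 ^ 2 - ‖(c' t).2‖ ^ 2)
      ≤ properTime (c a) (c b) := by
  have hcont₁ : ContinuousOn (fun t => (c' t).1) (Icc a b) := hcont.fst
  have hcont₂ : ContinuousOn (fun t => (c' t).2) (Icc a b) := hcont.snd
  have htime : ∫ t in a..b, (c' t).1 = (c b).1 - (c a).1 :=
    intervalIntegral.integral_eq_sub_of_hasDerivAt (f := fun t => (c t).1)
      (fun t ht => (hderiv t (uIcc_of_le hab.le ▸ ht)).fst)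
      (hcont₁.intervalIntegrable_of_Icc hab.le)
  have hspace : ∫ t in a..b, (c' t).2 = (c b).2 - (c a).2 :=
    intervalIntegral.integral_eq_sub_of_hasDerivAt (f := fun t => (c t).2)
      (fun t ht => (hderiv t (uIcc_of_le hab.le ▸ ht)).snd)
      (hcont₂.intervalIntegrable_of_Icc hab.le)
  have hchron : ‖(c b).2 - (c a).2‖ < (c b).1 - (c a).1 := by
    rw [← htime, ← hspace]
    exact (intervalIntegral.norm_integral_le_integral_norm hab.le).trans_lt
      (intervalIntegral.integral_lt_integral_of_continuousOn_of_le_of_exists_lt hab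
        hcont₂.norm hcont₁ (fun t ht => (htl t (Ioc_subset_Icc_self ht)).le)
        ⟨a, left_mem_Icc.2 hab.le, htl a (left_mem_Icc.2 hab.le)⟩)
  refine ⟨hchron, ?_⟩
  have hspeed : ∫ t in a..b, √(√((c' t).1 ^ 2 - ‖(c' t).2‖ ^ 2) ^ 2 + ‖(c' t).2‖ ^ 2) =
      ∫ t in a..b, (c' t).1 := by
    refine intervalIntegral.integral_congr fun t ht => ?_
    have h := htl t (uIcc_of_le hab.le ▸ ht)
    have h₀ := norm_nonneg (c' t).2
    rw [Real.sq_sqrt (by nlinarith), sub_add_cancel, Real.sqrt_sq (h₀.trans h.le)]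
  have hcont_speed : ContinuousOn (fun t => √((c' t).1 ^ 2 - ‖(c' t).2‖ ^ 2)) (Icc a b) :=
    ((hcont₁.pow 2).sub (hcont₂.norm.pow 2)).sqrt
  have hle := sqrt_sq_integral_add_sq_norm_integral_le hab.le hcont_speed hcont₂
  rw [hspeed, htime, hspace,
    Real.sqrt_le_left ((norm_nonneg _).trans hchron.le)] at hle
  exact Real.le_sqrt_of_sq_le (by linarith)
end
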